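/- In the variant of the content-relationship logic S with intersected set assignment, the formula p → ¬(¬p ∧ ¬q) is not a semantic consequence of {p}: there exists an S-model that satisfies p but does not satisfy p → ¬(¬p ∧ ¬q), where p and q are distinct propositional variables. -/

import Mathlib

namespace SLogic

/-- Formulae of the variant of the content-relationship logic S: built from propositional
variables by ¬, ∧, →. -/
inductive SForm : Type where
  | var : ℕ → SForm
  | neg : SForm → SForm
  | conj : SForm → SForm → SForm
  | impl : SForm → SForm → SForm

/-- The variables occurring in a formula. -/
def SForm.vars : SForm → Set ℕ
  | .var p => {p}
  | .neg A => A.vars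
  | .conj A B => A.vars ∪ B.vars
  | .impl A B => A.vars ∪ B.vars

/-- An S-model `⟨ϑ, s⟩` (with intersected set assignment): a valuation of variables, a
nonempty set `W` of nonempty sets, and a content assignment `s` such that the content of
every formula is the intersection of the contents (members of `W`) of its variables. -/
structure SModel (α : Type) where
  ϑ : ℕ → Bool
  W : Set (Set α)
  Wne : W.Nonempty
  Une : ∀ U ∈ W, U.Nonempty
  s : SForm → Set α
  sdef : ∀ A : SForm,
    s A = ⋂₀ {U | U ∈ W ∧ ∃ p ∈ A.vars, s (SForm.var p) = U}

/-- Satisfaction in an S-model. -/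
def SModel.Sat {α : Type} (M : SModel α) : SForm → Prop
  | .var p => M.ϑ p = true
  | .neg A => ¬ M.Sat A
  | .conj A B => M.Sat A ∧ M.Sat B
  | .impl A B => (¬ M.Sat A ∨ M.Sat B) ∧ (M.s A ∩ M.s B).Nonempty

/-- The two-point model in which `p` has content `{true}` and every other variable has
content `{false}`; all variables are true. -/
def separatingModel (p : ℕ) : SModel Bool where
  ϑ _ := true
  W := {{true}, {false}}
  Wne := ⟨{true}, Or.inl rfl⟩
  Une := by
    rintro U (rfl | rfl) <;> exact Set.singleton_nonempty _
  s A := ⋂ n ∈ A.vars, {decide (n = p)}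
  sdef A := by
    ext b
    simp only [SForm.vars, Set.mem_iInter, Set.mem_sInter, Set.mem_singleton_iff,
      Set.iInter_iInter_eq_left]
    constructor
    · rintro h U ⟨-, n, hn, rfl⟩
      exact h n hn
    · intro h n hn
      refine h {decide (n = p)} ⟨?_, n, hn, rfl⟩
      by_cases hnp : n = p <;> simp [hnp]

/-- `p → ¬(¬p ∧ ¬q)` is not a semantic consequence of `{p}` in the
S-variant: some S-model satisfies `p` but not `p → ¬(¬p ∧ ¬q)`. -/
theorem not_conseq_counterexample (p q : ℕ) (hpq : p ≠ q) :
    ∃ (α : Type) (M : SModel α),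
      M.Sat (.var p) ∧
      ¬ M.Sat (.impl (.var p) (.neg (.conj (.neg (.var p)) (.neg (.var q))))) := by
  refine ⟨Bool, separatingModel p, rfl, ?_⟩
  rintro ⟨-, b, hp, hpq'⟩
  simp only [separatingModel, SForm.vars, Set.mem_iInter, Set.mem_singleton_iff,
    Set.mem_union] at hp hpq'
  have hb_true := hp p rfl
  have hb_false := hpq' q (Or.inr rfl)
  simp [hb_true, hpq.symm] at hb_false

end SLogic
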